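/- Fix an even integer q = 2p with p ≥ 2 and let λ = 2·cos(π/q). For every G_q-irrational x ∈ [−λ/2, λ/2) there are infinitely many n ≥ 1 with (t_n, v_n) ∉ D; equivalently, there are infinitely many n ≥ 1 for which min{Θ_{n−1}(x), Θ_n(x)} ≤ 1/2. -/

import Mathlib

noncomputable section

open Real Filter Topology MeasureTheory
open scoped Classical

namespace RosenTong

/-- `λ_q = 2 cos(π/q)`. -/
def lam (q : ℕ) : ℝ := 2 * Real.cos (Real.pi / q)

/-- The Rosen map `f_q` on `[-λ/2, λ/2)`. -/
def f (l : ℝ) (x : ℝ) : ℝ :=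
  if x = 0 then 0 else 1 / |x| - l * (⌊1 / (l * |x|) + 1 / 2⌋ : ℝ)

/-- `x` is `G_q`-irrational: its Rosen orbit never hits `0`. -/
def Irr (l : ℝ) (x : ℝ) : Prop := ∀ n : ℕ, (f l)^[n] x ≠ 0

/-- `ε_n = sign (f^{n-1} x)` (for `n ≥ 1`). -/
def eps (l x : ℝ) (n : ℕ) : ℝ := Real.sign ((f l)^[n - 1] x)

/-- `r_n = ⌊1/(λ |f^{n-1} x|) + 1/2⌋` (for `n ≥ 1`), as a real number. -/
def rr (l x : ℝ) (n : ℕ) : ℝ := (⌊1 / (l * |(f l)^[n - 1] x|) + 1 / 2⌋ : ℝ)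

/-- `((R_{n-1}, R_n), (S_{n-1}, S_n))`. -/
def RS (l x : ℝ) : ℕ → (ℝ × ℝ) × (ℝ × ℝ)
  | 0 => ((1, 0), (0, 1))
  | n + 1 =>
      (((RS l x n).1.2, rr l x (n + 1) * l * (RS l x n).1.2 + eps l x (n + 1) * (RS l x n).1.1),
       ((RS l x n).2.2, rr l x (n + 1) * l * (RS l x n).2.2 + eps l x (n + 1) * (RS l x n).2.1))

/-- Numerator `R_n` of the `n`-th Rosen convergent. -/
def Rnum (l x : ℝ) (n : ℕ) : ℝ := (RS l x n).1.2

/-- Denominator `S_n` of the `n`-th Rosen convergent. -/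
def Snum (l x : ℝ) (n : ℕ) : ℝ := (RS l x n).2.2

/-- The approximation coefficient `Θ_n = S_n² |x - R_n/S_n|`. -/
def theta (l x : ℝ) (n : ℕ) : ℝ := (Snum l x n) ^ 2 * |x - Rnum l x n / Snum l x n|

/-- The natural extension map `𝒯(x,y) = (f x, 1/(r(x)λ + ε(x) y))`. -/
def T (l : ℝ) (z : ℝ × ℝ) : ℝ × ℝ :=
  (f l z.1, 1 / ((⌊1 / (l * |z.1|) + 1 / 2⌋ : ℝ) * l + Real.sign z.1 * z.2))

/-- `(t_n, v_n) = 𝒯^n (x, 0)`. -/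
def tv (l x : ℝ) (n : ℕ) : ℝ × ℝ := (T l)^[n] (x, 0)

/-- `G(y) = -1/(λ + y)`. -/
def G (l : ℝ) (y : ℝ) : ℝ := -1 / (l + y)

/-- `C(y) = -1/(2λ + y)`. -/
def CC (l : ℝ) (y : ℝ) : ℝ := -1 / (2 * l + y)

/-- `τ_k` in the even case `q = 2p`. -/
def tauE (l : ℝ) (p : ℕ) : ℕ → ℝ
  | 0 => -2 / (3 * l)
  | k + 1 => -1 / (2 * l + (G l)^[p - 2] (tauE l p k))

/-- `τ_k` in the odd case `q = 2h+3`. -/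
def tauO (l : ℝ) (h : ℕ) : ℕ → ℝ
  | 0 => -2 / (3 * l)
  | k + 1 => CC l ((G l)^[h] (CC l ((G l)^[h - 1] (tauO l h k))))

/-- `φ_j = f^j(-λ/2)`. -/
def phi (l : ℝ) (j : ℕ) : ℝ := (f l)^[j] (-(l / 2))

/-- The heights `L_j` in the even case: `L_1 = 1/(λ+1)`, `L_j = 1/(λ - L_{j-1})`. -/
def LE (l : ℝ) : ℕ → ℝ
  | 0 => 0
  | 1 => 1 / (l + 1)
  | j + 2 => 1 / (l - LE l (j + 1))

/-- The natural extension domain `Ω` in the even case `q = 2p`. -/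
def OmegaE (l : ℝ) (p : ℕ) : Set (ℝ × ℝ) :=
  (⋃ j ∈ Finset.Icc 1 (p - 1),
    (Set.Ico (phi l (j - 1)) (phi l j)) ×ˢ (Set.Icc 0 (LE l j)))
  ∪ (Set.Ico (0 : ℝ) (l / 2)) ×ˢ (Set.Icc (0 : ℝ) 1)

/-- The region `D` (even case): both `Θ_{n-1}` and `Θ_n` exceed `1/2`. -/
def DE (l : ℝ) (p : ℕ) : Set (ℝ × ℝ) :=
  {z ∈ OmegaE l p | z.2 / (1 + z.1 * z.2) > 1 / 2 ∧ |z.1| / (1 + z.1 * z.2) > 1 / 2}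

/-- The region `A = {(t,v) ∈ D : -2/(3λ) ≤ t ≤ -1/(λ+1)}`. -/
def AE (l : ℝ) (p : ℕ) : Set (ℝ × ℝ) :=
  {z ∈ DE l p | -2 / (3 * l) ≤ z.1 ∧ z.1 ≤ -1 / (l + 1)}

/-- `A_k = {(t,v) ∈ A : t ≥ τ_k}`. -/
def AEk (l : ℝ) (p k : ℕ) : Set (ℝ × ℝ) :=
  {z ∈ AE l p | tauE l p k ≤ z.1}

/-- The invariant measure `ν` (even case), with density `C_q/(1+tv)²` on `Ω`. -/
def nuE (q p : ℕ) : Measure (ℝ × ℝ) :=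
  (volume.restrict (OmegaE (lam q) p)).withDensity fun z =>
    ENNReal.ofReal
      ((1 / Real.log ((1 + Real.cos (Real.pi / q)) / Real.sin (Real.pi / q))) /
        (1 + z.1 * z.2) ^ 2)

/-- The Hurwitz constant `H_q` for odd `q`. -/
def Hodd (l : ℝ) : ℝ := 1 / (2 * Real.sqrt ((1 - l / 2) ^ 2 + 1) )

/-- The positive root `R` of `R² + (2-λ)R - 1 = 0` (odd case). -/
def Rodd (l : ℝ) : ℝ := (l - 2 + Real.sqrt ((2 - l) ^ 2 + 4)) / 2

/-- Two backward orbits of `s ↦ l - 1/s` of length `m`: `L` runs from `1/(l+1)` to `l-1`,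
and `H` runs from `0` to `l/2`. -/
structure BackwardOrbits (l : ℝ) (m : ℕ) (L H : ℕ → ℝ) : Prop where
  one_lt : 1 < l
  lt_two : l < 2
  one_le : 1 ≤ m
  L_one : L 1 = 1 / (l + 1)
  L_last : L m = l - 1
  L_pos : ∀ j, 1 ≤ j → j ≤ m → 0 < L j
  L_succ : ∀ j, 1 ≤ j → j + 1 ≤ m → L (j + 1) * (l - L j) = 1
  H_zero : H 0 = 0
  H_last : H m = l / 2
  H_pos : ∀ j, 1 ≤ j → j ≤ m → 0 < H j
  H_succ : ∀ j, j + 1 ≤ m → H (j + 1) * (l - H j) = 1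

lemma sin_ratio_succ {θ u : ℝ} (h1 : Real.sin u ≠ 0) (h2 : Real.sin (u + θ) ≠ 0) :
    Real.sin u / Real.sin (u + θ) * (2 * Real.cos θ - Real.sin (u - θ) / Real.sin u) = 1 := by
  have h : Real.sin (u + θ) = 2 * Real.cos θ * Real.sin u - Real.sin (u - θ) := by
    rw [Real.sin_add, Real.sin_sub]; ring
  field_simp
  linarith

lemma exists_backwardOrbits {p : ℕ} (hp : 2 ≤ p) :
    ∃ L H, BackwardOrbits (lam (2 * p)) (p - 1) L H := by
  obtain ⟨m, rfl⟩ : ∃ m, p = m + 1 := ⟨p - 1, by omega⟩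
  have hm : 1 ≤ m := by omega
  have hmR : (1 : ℝ) ≤ m := by exact_mod_cast hm
  obtain ⟨θ, hθ⟩ : ∃ θ : ℝ, θ = Real.pi / ((2 * (m + 1) : ℕ) : ℝ) := ⟨_, rfl⟩
  have hθ' : (m + 1) * θ = Real.pi / 2 := by
    rw [hθ]; push_cast; field_simp
  have hpi := Real.pi_pos
  have hθpos : 0 < θ := by rw [hθ]; positivity
  have hθle : 2 * θ ≤ Real.pi / 2 := by nlinarith
  have hl : lam (2 * (m + 1)) = 2 * Real.cos θ := by rw [lam, hθ]
  have hsin : ∀ a : ℝ, 0 < a → a ≤ m + 1 → 0 < Real.sin (a * θ) := fun a ha ha' =>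
    Real.sin_pos_of_pos_of_lt_pi (by positivity) (by nlinarith)
  have hcos : 1 / 2 < Real.cos θ := by
    rw [← Real.cos_pi_div_three]
    exact Real.cos_lt_cos_of_nonneg_of_le_pi_div_two hθpos.le (by linarith) (by linarith)
  have hcos' : Real.cos θ < 1 := by
    rw [← Real.cos_zero]
    exact Real.cos_lt_cos_of_nonneg_of_le_pi_div_two le_rfl (by linarith) hθpos
  have hlast : ∀ a : ℝ, Real.sin ((m + 1 - a) * θ) = Real.cos (a * θ) := fun a => by
    rw [sub_mul, hθ', Real.sin_pi_div_two_sub]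
  have hsucc : ∀ a : ℝ, 0 < a → a ≤ m →
      Real.sin (a * θ) / Real.sin ((a + 1) * θ) *
        (2 * Real.cos θ - Real.sin ((a - 1) * θ) / Real.sin (a * θ)) = 1 := fun a ha ha' => by
    have h := sin_ratio_succ (θ := θ) (hsin a ha (by linarith)).ne'
      (by have := (hsin (a + 1) (by linarith) (by linarith)).ne'; rwa [add_mul, one_mul] at this)
    rwa [add_mul, sub_mul, one_mul]
  have hc := Real.cos_three_mul (θ / 2)
  have hs := Real.sin_three_mul (θ / 2)
  have hc2 : Real.cos θ = 2 * Real.cos (θ / 2) ^ 2 - 1 := by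
    rw [← Real.cos_two_mul]; ring_nf
  have hsc := Real.sin_sq_add_cos_sq (θ / 2)
  refine ⟨fun j => Real.sin ((j - 1 / 2) * θ) / Real.sin ((j - 1 / 2 + 1) * θ),
    fun j => Real.sin (j * θ) / Real.sin ((j + 1) * θ), ?_⟩
  rw [hl, Nat.add_sub_cancel]
  refine ⟨by linarith, by linarith, hm, ?_, ?_, ?_, ?_, by simp, ?_, ?_, ?_⟩
  · have h0 : 0 < Real.sin (θ / 2) := by
      have := hsin (1 / 2) (by norm_num) (by linarith)
      rwa [one_div_mul_eq_div] at this
    have e1 : (((1 : ℕ) : ℝ) - 1 / 2) * θ = θ / 2 := by push_cast; ring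
    have e2 : (((1 : ℕ) : ℝ) - 1 / 2 + 1) * θ = 3 * (θ / 2) := by push_cast; ring
    have h3 : Real.sin (3 * (θ / 2)) = Real.sin (θ / 2) * (2 * Real.cos θ + 1) := by
      rw [hs, hc2]; linear_combination (-4 * Real.sin (θ / 2)) * hsc
    simp only [e1, e2]
    rw [h3]
    field_simp
  · have e1 : ((m : ℝ) - 1 / 2) * θ = (m + 1 - 3 / 2) * θ := by ring
    have e2 : ((m : ℝ) - 1 / 2 + 1) * θ = (m + 1 - 1 / 2) * θ := by ring
    have e3 : 3 / 2 * θ = 3 * (θ / 2) := by ring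
    have e4 : 1 / 2 * θ = θ / 2 := by ring
    have h0 : 0 < Real.cos (θ / 2) :=
      Real.cos_pos_of_mem_Ioo ⟨by linarith, by linarith⟩
    simp only [e1, e2]
    rw [hlast, hlast, e3, e4, hc, hc2]
    field_simp
    ring
  · intro j hj hj'
    have hj1 : (1 : ℝ) ≤ j := by exact_mod_cast hj
    have hj2 : (j : ℝ) ≤ m := by exact_mod_cast hj'
    exact div_pos (hsin _ (by linarith) (by linarith)) (hsin _ (by linarith) (by linarith))
  · intro j hj hj'
    have hj1 : (1 : ℝ) ≤ j := by exact_mod_cast hj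
    have hj2 : (j : ℝ) + 1 ≤ m := by exact_mod_cast hj'
    have h := hsucc (j + 1 / 2) (by linarith) (by linarith)
    convert h using 3 <;> push_cast <;> ring_nf
  · have h := hlast 1
    have h' := hlast 0
    rw [one_mul] at h
    rw [sub_zero, zero_mul, Real.cos_zero] at h'
    simp only [h']
    rw [← h]
    ring_nf
  · intro j hj hj'
    have hj1 : (1 : ℝ) ≤ j := by exact_mod_cast hj
    have hj2 : (j : ℝ) ≤ m := by exact_mod_cast hj'
    exact div_pos (hsin _ (by linarith) (by linarith)) (hsin _ (by linarith) (by linarith))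
  · intro j hj'
    have hj1 : (0 : ℝ) ≤ j := Nat.cast_nonneg j
    have hj2 : (j : ℝ) + 1 ≤ m := by exact_mod_cast hj'
    have h := hsucc (j + 1) (by linarith) (by linarith)
    convert h using 3 <;> push_cast <;> ring_nf

/-- The Rosen digit `r(t) = ⌊1/(l|t|) + 1/2⌋`. -/
def digit (l t : ℝ) : ℤ := ⌊1 / (l * |t|) + 1 / 2⌋

lemma f_eq {l t : ℝ} (ht : t ≠ 0) : f l t = 1 / |t| - l * digit l t := by
  simp [f, ht, digit]

lemma f_mem {l t : ℝ} (hl : 0 < l) (ht : t ≠ 0) : f l t ∈ Set.Ico (-(l / 2)) (l / 2) := by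
  rw [f_eq ht]
  have ht' : 0 < |t| := abs_pos.2 ht
  have h1 := Int.floor_le (1 / (l * |t|) + 1 / 2)
  have h2 := Int.lt_floor_add_one (1 / (l * |t|) + 1 / 2)
  have e : 1 / |t| = l * (1 / (l * |t|)) := by field_simp
  rw [e]
  unfold digit
  constructor <;> nlinarith

lemma one_le_digit {l t : ℝ} (hl : 0 < l) (hl2 : l < 2) (ht : t ≠ 0) (ht2 : |t| ≤ l / 2) :
    1 ≤ digit l t := by
  have ht' : 0 < |t| := abs_pos.2 ht
  rw [digit, Int.le_floor]
  have : 1 / 2 ≤ 1 / (l * |t|) :=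
    one_div_le_one_div_of_le (by positivity) (by nlinarith)
  push_cast
  linarith

lemma digit_eq_one {l t : ℝ} (hl : 0 < l) (hl2 : l < 2) (ht : 1 ≤ l * |t|) (ht2 : |t| ≤ l / 2) :
    digit l t = 1 := by
  have h0 : t ≠ 0 := by
    rintro rfl
    norm_num at ht
  refine le_antisymm ?_ (one_le_digit hl hl2 h0 ht2)
  rw [← Int.lt_add_one_iff, digit, Int.floor_lt]
  have : 1 / (l * |t|) ≤ 1 := by
    rw [div_le_one (by linarith)]; exact ht
  push_cast
  linarith

/-- The upper boundary of the natural extension domain, in terms of the two orbits. -/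
structure InDomain (l : ℝ) (m : ℕ) (L H : ℕ → ℝ) (z : ℝ × ℝ) : Prop where
  fst_mem : z.1 ∈ Set.Ico (-(l / 2)) (l / 2)
  snd_nonneg : 0 ≤ z.2
  snd_le_one : z.2 ≤ 1
  snd_le : ∀ i j, 1 ≤ j → i + j = m → H i < -z.1 → z.2 ≤ L j

section Dynamics

variable {l : ℝ} {m : ℕ} {L H : ℕ → ℝ}

lemma InDomain.snd_le_of_neg (B : BackwardOrbits l m L H) {z : ℝ × ℝ} (hz : InDomain l m L H z)
    (h : z.1 < 0) : z.2 ≤ l - 1 := by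
  rw [← B.L_last]
  exact hz.snd_le 0 m B.one_le (by omega) (by rw [B.H_zero]; linarith)

lemma InDomain.abs_le {z : ℝ × ℝ} (hz : InDomain l m L H z) : |z.1| ≤ l / 2 :=
  _root_.abs_le.2 ⟨hz.fst_mem.1, hz.fst_mem.2.le⟩

lemma InDomain.denom_ge_one (B : BackwardOrbits l m L H) {z : ℝ × ℝ} (hz : InDomain l m L H z)
    (h0 : z.1 ≠ 0) : 1 ≤ (digit l z.1 : ℝ) * l + Real.sign z.1 * z.2 := by
  have hl := B.one_lt
  have hr : (1 : ℝ) ≤ digit l z.1 := by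
    exact_mod_cast one_le_digit (by linarith) B.lt_two h0 hz.abs_le
  have := hz.snd_nonneg
  rcases lt_or_gt_of_ne h0 with h | h
  · have := hz.snd_le_of_neg B h
    rw [Real.sign_of_neg h]
    nlinarith
  · rw [Real.sign_of_pos h]
    nlinarith

lemma BackwardOrbits.inv_le_L (B : BackwardOrbits l m L H) {j : ℕ} (hj : 2 ≤ j) (hjm : j ≤ m) :
    1 / l ≤ L j := by
  obtain ⟨k, rfl⟩ : ∃ k, j = k + 1 := ⟨j - 1, by omega⟩
  have h1 := B.L_succ k (by omega) hjm
  have h2 := B.L_pos k (by omega) (by omega)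
  have h3 := B.L_pos (k + 1) (by omega) hjm
  have hl := B.one_lt
  rw [div_le_iff₀ (by linarith)]
  nlinarith

lemma BackwardOrbits.L_one_le (B : BackwardOrbits l m L H) {j : ℕ} (hj : 1 ≤ j) (hjm : j ≤ m) :
    1 / (l + 1) ≤ L j := by
  have hl := B.one_lt
  rcases eq_or_lt_of_le hj with rfl | hj
  · exact B.L_one.ge
  · exact (one_div_le_one_div_of_le (by linarith) (by linarith)).trans (B.inv_le_L hj hjm)

lemma BackwardOrbits.H_succ_lt (B : BackwardOrbits l m L H) {i : ℕ} (hi : i + 1 ≤ m) {a : ℝ}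
    (ha : 0 < a) (h : H i < l - 1 / a) : H (i + 1) < a := by
  have h1 := B.H_succ i hi
  have h2 := B.H_pos (i + 1) (by omega) hi
  have h3 : 1 / a * a = 1 := by field_simp
  by_contra! h4
  have h5 : 1 / H (i + 1) ≤ 1 / a := one_div_le_one_div_of_le ha h4
  have h6 : 1 / H (i + 1) = l - H i := by
    rw [div_eq_iff h2.ne']; linarith
  linarith

lemma BackwardOrbits.le_H (B : BackwardOrbits l m L H) {i : ℕ} (hi : i + 1 ≤ m) {a : ℝ}
    (ha : 0 < a) (h : a ≤ H (i + 1)) : l - 1 / a ≤ H i := by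
  by_contra! h'
  exact absurd (B.H_succ_lt hi ha h') (not_lt.2 h)

lemma InDomain.map (B : BackwardOrbits l m L H) {z : ℝ × ℝ} (hz : InDomain l m L H z)
    (h0 : z.1 ≠ 0) : InDomain l m L H (T l z) := by
  have hl := B.one_lt
  have hd := hz.denom_ge_one B h0
  have habs : 0 < |z.1| := abs_pos.2 h0
  have hrZ := one_le_digit (by linarith) B.lt_two h0 hz.abs_le
  have hT : T l z = (1 / |z.1| - l * digit l z.1,
      1 / ((digit l z.1 : ℝ) * l + Real.sign z.1 * z.2)) := by
    rw [T, f_eq h0, digit]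
  have hfm := f_mem (l := l) (by linarith) h0
  rw [f_eq h0] at hfm
  rw [hT]
  refine ⟨hfm, by positivity, ?_, ?_⟩
  · rw [div_le_one (by linarith)]; exact hd
  intro i j hj hij hlt
  have hv := hz.snd_nonneg
  rcases eq_or_lt_of_le hrZ with hr | hr
  · have hs : H (i + 1) < |z.1| := B.H_succ_lt (by omega) habs (by
      rw [← hr] at hlt; push_cast at hlt; linarith)
    have hj2 : 2 ≤ j := by
      by_contra! hj2
      obtain rfl : i + 1 = m := by omega
      rw [B.H_last] at hs
      linarith [hz.abs_le]
    simp only [← hr, Int.cast_one, one_mul] at hd ⊢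
    rcases lt_or_gt_of_ne h0 with h | h
    · obtain ⟨k, rfl⟩ : ∃ k, j = k + 1 := ⟨j - 1, by omega⟩
      have h1 := hz.snd_le (i + 1) k (by omega) (by omega) (by rwa [abs_of_neg h] at hs)
      have h2 := B.L_succ k (by omega) (by omega)
      have h3 := B.L_pos (k + 1) (by omega) (by omega)
      rw [div_le_iff₀ (by linarith), Real.sign_of_neg h]
      nlinarith
    · refine le_trans ?_ (B.inv_le_L hj2 (by omega))
      rw [Real.sign_of_pos h]
      exact one_div_le_one_div_of_le (by linarith) (by linarith)
  · have hr2 : (2 : ℝ) ≤ digit l z.1 := by exact_mod_cast hr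
    refine le_trans ?_ (B.L_one_le hj (by omega))
    apply one_div_le_one_div_of_le (by linarith)
    rcases lt_or_gt_of_ne h0 with h | h
    · have := hz.snd_le_of_neg B h
      rw [Real.sign_of_neg h]
      nlinarith
    · rw [Real.sign_of_pos h]
      nlinarith

lemma BackwardOrbits.inDomain_start (B : BackwardOrbits l m L H) {x : ℝ}
    (hx : x ∈ Set.Ico (-(l / 2)) (l / 2)) : InDomain l m L H (x, 0) :=
  ⟨hx, le_rfl, zero_le_one, fun _ j hj hij _ => (B.L_pos j hj (by omega)).le⟩

lemma tv_succ (l x : ℝ) (n : ℕ) : tv l x (n + 1) = T l (tv l x n) := by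
  rw [tv, Function.iterate_succ_apply', ← tv]

lemma tv_fst (l x : ℝ) (n : ℕ) : (tv l x n).1 = (f l)^[n] x := by
  induction n with
  | zero => rfl
  | succ n ih => rw [tv_succ, T, ih, Function.iterate_succ_apply']

lemma BackwardOrbits.inDomain_tv (B : BackwardOrbits l m L H) {x : ℝ}
    (hx : x ∈ Set.Ico (-(l / 2)) (l / 2)) (hirr : Irr l x) (n : ℕ) :
    InDomain l m L H (tv l x n) := by
  induction n with
  | zero => exact B.inDomain_start hx
  | succ n ih =>
    rw [tv_succ]
    exact ih.map B (by rw [tv_fst]; exact hirr n)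

/-- A bounded sequence following the branches `s ↦ rl - 1/s`, `r ≥ 1`, with `r = 1` as soon as
`1 ≤ ls`, cannot stay above `1/(l+1)`: the orbit `L` is repelling. -/
lemma BackwardOrbits.not_forall_gt (B : BackwardOrbits l m L H) (s : ℕ → ℝ) (r : ℕ → ℤ)
    (hr : ∀ n, 1 ≤ r n) (hr1 : ∀ n, 1 ≤ l * s n → r n = 1)
    (hs : ∀ n, s (n + 1) = r n * l - 1 / s n) (hle : ∀ n, s n ≤ l / 2) :
    ¬ ∀ n, 1 / (l + 1) < s n := by
  intro hgt
  have hl := B.one_lt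
  have hl2 := B.lt_two
  have hpos : ∀ n, 0 < s n := fun n => lt_trans (by positivity) (hgt n)
  have hinv : ∀ n, 1 / s n < l + 1 := fun n => by
    have := hgt n
    rw [div_lt_iff₀ (by linarith)] at this
    rw [div_lt_iff₀ (hpos n)]
    linarith
  have hr2 : ∀ n, r n ≠ 1 → r n = 2 := fun n hn => by
    have h1 := hr n
    by_contra h2
    have h3 : (3 : ℝ) ≤ r n := by exact_mod_cast (show (3 : ℤ) ≤ r n by omega)
    have h4 := hs n
    have h5 := hle (n + 1)
    have h6 := hinv n
    nlinarith
  have hret : ∀ n, r n ≠ 1 → L m < s (n + 1) := fun n hn => by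
    rw [hs, hr2 n hn, B.L_last]
    push_cast
    linarith [hinv n]
  have hstart : ∀ j, j ≤ m → ∀ n, s n ≤ H j → ∃ k, L m < s k := by
    intro j
    induction j with
    | zero =>
      intro _ n hn
      rw [B.H_zero] at hn
      exact absurd (hpos n) (not_lt.2 hn)
    | succ j ih =>
      intro hj n hn
      by_cases h1 : r n = 1
      · refine ih (by omega) (n + 1) ?_
        rw [hs, h1]
        push_cast
        rw [one_mul]
        exact B.le_H hj (hpos n) hn
      · exact ⟨n + 1, hret n h1⟩
  have hdouble : ∀ j, 1 ≤ j → j ≤ m → ∀ n d, 0 < d → s n ≤ H j → d ≤ s n - L j →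
      ∃ k, 2 * d ≤ s k - L m := by
    intro j hj
    induction j, hj using Nat.le_induction with
    | base =>
      intro _ n d hd hn hdn
      have hH := B.H_succ 0 B.one_le
      rw [B.H_zero, zero_add, sub_zero] at hH
      have hsl : s n * l ≤ 1 := by nlinarith
      have h1 : r n ≠ 1 := fun h1 => by
        have h2 := hs n
        have h3 := hpos (n + 1)
        rw [h1] at h2
        push_cast at h2
        have h4 : 1 / s n * s n = 1 := by have := hpos n; field_simp
        have := hpos n
        nlinarith
      refine ⟨n + 1, ?_⟩
      rw [hs, hr2 n h1, B.L_last]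
      rw [B.L_one] at hdn
      push_cast
      have hp := hpos n
      have h5 : 2 * d * s n ≤ (l + 1) * s n - 1 := by
        have e : (l + 1) * (s n - 1 / (l + 1)) = (l + 1) * s n - 1 := by field_simp
        rw [← e]
        have : s n ≤ 1 := by nlinarith
        nlinarith
      have h6 : 2 * d ≤ (l + 1) - 1 / s n := by
        rw [← sub_nonneg]
        have : (l + 1) - 1 / s n - 2 * d = ((l + 1) * s n - 1 - 2 * d * s n) / s n := by
          field_simp
        rw [this]
        exact div_nonneg (by linarith) hp.le
      linarith
    | succ j hj ih =>
      intro hjm n d hd hn hdn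
      have hp := hpos n
      have hLj := B.inv_le_L (show 2 ≤ j + 1 by omega) hjm
      have hL1 := B.L_succ j hj hjm
      have hLpos := B.L_pos (j + 1) (by omega) hjm
      have hsn : 1 / l ≤ s n := by linarith
      have h1 : r n = 1 := hr1 n (by
        rw [div_le_iff₀ (by linarith)] at hsn
        linarith)
      have hsuc := hs n
      rw [h1, Int.cast_one, one_mul] at hsuc
      refine ih (by omega) (n + 1) d hd ?_ ?_
      · rw [hsuc]
        exact B.le_H hjm hp hn
      · have e : s (n + 1) - L j = (s n - L (j + 1)) / (s n * L (j + 1)) := by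
          have : L j = l - 1 / L (j + 1) := by field_simp; linarith
          rw [hsuc, this]
          field_simp
          ring
        rw [e]
        refine hdn.trans (le_div_self (by linarith) (by positivity) ?_)
        have := hle n
        nlinarith
  obtain ⟨k, hk⟩ := hstart m le_rfl 0 (by rw [B.H_last]; exact hle 0)
  have hpow : ∀ i : ℕ, ∃ n, 2 ^ i * (s k - L m) ≤ s n - L m := by
    intro i
    induction i with
    | zero => exact ⟨k, by simp⟩
    | succ i ih =>
      obtain ⟨n, hn⟩ := ih
      obtain ⟨n', hn'⟩ := hdouble m B.one_le le_rfl n (2 ^ i * (s k - L m))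
        (mul_pos (by positivity) (by linarith)) (by rw [B.H_last]; exact hle n) hn
      exact ⟨n', by rw [pow_succ]; linarith⟩
  obtain ⟨i, hi⟩ := pow_unbounded_of_one_lt (1 / (s k - L m)) (one_lt_two (α := ℝ))
  obtain ⟨n, hn⟩ := hpow i
  rw [div_lt_iff₀ (by linarith)] at hi
  have := hle n
  have := B.L_pos m B.one_le le_rfl
  linarith

lemma InDomain.one_add_pos (B : BackwardOrbits l m L H) {z : ℝ × ℝ} (hz : InDomain l m L H z) :
    0 < 1 + z.1 * z.2 := by
  have h1 := hz.fst_mem.1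
  have h2 := hz.snd_le_one
  have h3 := hz.snd_nonneg
  have := B.lt_two
  have := B.one_lt
  nlinarith [mul_nonneg (neg_le_iff_add_nonneg.1 h1) h3]

lemma InDomain.neg_of_gt (B : BackwardOrbits l m L H) {z : ℝ × ℝ} (hz : InDomain l m L H z)
    (h1 : 1 / 2 < z.2 / (1 + z.1 * z.2)) (h2 : 1 / 2 < |z.1| / (1 + z.1 * z.2)) :
    z.1 < 0 ∧ 1 / (l + 1) < -z.1 := by
  have hp := hz.one_add_pos B
  have hl := B.one_lt
  have hl2 := B.lt_two
  have := hz.fst_mem.1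
  have := hz.fst_mem.2
  have := hz.snd_le_one
  have hv := hz.snd_nonneg
  rw [lt_div_iff₀ hp] at h1 h2
  have hneg : z.1 < 0 := by
    by_contra! h
    rw [abs_of_nonneg h] at h2
    nlinarith
  refine ⟨hneg, ?_⟩
  have := hz.snd_le_of_neg B hneg
  rw [abs_of_neg hneg] at h2
  rw [div_lt_iff₀ (by linarith)]
  nlinarith

/-- Both coefficients cannot stay above `1/2` from some time on. -/
lemma BackwardOrbits.exists_coeff_le (B : BackwardOrbits l m L H) {x : ℝ}
    (hx : x ∈ Set.Ico (-(l / 2)) (l / 2)) (hirr : Irr l x) (N : ℕ) :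
    ∃ n, N ≤ n ∧ ¬ (1 / 2 < (tv l x n).2 / (1 + (tv l x n).1 * (tv l x n).2) ∧
      1 / 2 < |(tv l x n).1| / (1 + (tv l x n).1 * (tv l x n).2)) := by
  by_contra! hcon
  have hD := B.inDomain_tv hx hirr
  have h : ∀ n, (tv l x (N + n)).1 < 0 ∧ 1 / (l + 1) < -(tv l x (N + n)).1 := fun n =>
    let c := hcon (N + n) (by omega)
    (hD (N + n)).neg_of_gt B c.1 c.2
  have hl := B.one_lt
  refine B.not_forall_gt (fun n => -(tv l x (N + n)).1) (fun n => digit l (tv l x (N + n)).1)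
    (fun n => one_le_digit (by linarith) B.lt_two (h n).1.ne (hD _).abs_le)
    (fun n hn => digit_eq_one (by linarith) B.lt_two (by rwa [abs_of_neg (h n).1]) (hD _).abs_le)
    (fun n => ?_) (fun n => ?_) (fun n => (h n).2)
  · rw [← add_assoc, tv_succ, T, f_eq (h n).1.ne, abs_of_neg (h n).1]
    ring
  · have := (hD (N + n)).fst_mem.1
    linarith

/-- The relations between the convergents of `x` and its orbit under the natural extension. -/
lemma BackwardOrbits.RS_spec (B : BackwardOrbits l m L H) {x : ℝ}
    (hx : x ∈ Set.Ico (-(l / 2)) (l / 2)) (hirr : Irr l x) (n : ℕ) :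
    0 < (RS l x n).2.2 ∧ (RS l x n).2.1 = (tv l x n).2 * (RS l x n).2.2 ∧
      x * ((RS l x n).2.2 + (tv l x n).1 * (RS l x n).2.1) =
        (RS l x n).1.2 + (tv l x n).1 * (RS l x n).1.1 ∧
      |(RS l x n).1.1 * (RS l x n).2.2 - (RS l x n).1.2 * (RS l x n).2.1| = 1 := by
  induction n with
  | zero => simp [RS, tv]
  | succ n ih =>
    obtain ⟨h1, h2, h3, h4⟩ := ih
    have h0 : (tv l x n).1 ≠ 0 := by rw [tv_fst]; exact hirr n
    have hd := (B.inDomain_tv hx hirr n).denom_ge_one B h0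
    have hrr : rr l x (n + 1) = digit l (tv l x n).1 := by
      rw [rr, digit, tv_fst, Nat.add_sub_cancel]
    have heps : eps l x (n + 1) = Real.sign (tv l x n).1 := by
      rw [eps, tv_fst, Nat.add_sub_cancel]
    have ht1 : (tv l x (n + 1)).1 = 1 / |(tv l x n).1| - l * digit l (tv l x n).1 := by
      rw [tv_succ, T, f_eq h0]
    have ht2 : (tv l x (n + 1)).2 =
        1 / ((digit l (tv l x n).1 : ℝ) * l + Real.sign (tv l x n).1 * (tv l x n).2) := by
      rw [tv_succ, T, digit]
    simp only [RS, hrr, heps, ht1, ht2]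
    generalize (tv l x n).1 = t at *
    generalize (tv l x n).2 = v at *
    generalize (digit l t : ℝ) = r at *
    generalize (RS l x n).1.1 = R' at *
    generalize (RS l x n).1.2 = R at *
    generalize (RS l x n).2.1 = S' at *
    generalize (RS l x n).2.2 = S at *
    have hε : Real.sign t * |t| = t := by
      rcases lt_or_gt_of_ne h0 with h | h
      · rw [Real.sign_of_neg h, abs_of_neg h]; ring
      · rw [Real.sign_of_pos h, abs_of_pos h]; ring
    have hε1 : |Real.sign t| = 1 := by
      rcases lt_or_gt_of_ne h0 with h | h
      · rw [Real.sign_of_neg h]; norm_num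
      · rw [Real.sign_of_pos h]; norm_num
    have ha : |t| ≠ 0 := abs_ne_zero.2 h0
    generalize Real.sign t = ε at *
    have e : r * l * S + ε * S' = (r * l + ε * v) * S := by rw [h2]; ring
    refine ⟨?_, ?_, ?_, ?_⟩
    · rw [e]
      exact mul_pos (by linarith) h1
    · rw [e]
      field_simp
    · generalize |t| = a at *
      subst hε
      field_simp
      linear_combination h3
    · have e2 : R * (r * l * S + ε * S') - (r * l * R + ε * R') * S = -ε * (R' * S - R * S') := by
        ring
      rw [e2, abs_mul, h4, abs_neg, hε1, one_mul]

lemma RS_succ_fst (l x : ℝ) (n : ℕ) :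
    (RS l x (n + 1)).1.1 = Rnum l x n ∧ (RS l x (n + 1)).2.1 = Snum l x n := ⟨rfl, rfl⟩

lemma sq_mul_abs_sub_div {x R S a b : ℝ} (hS : 0 < S) (hb : 0 < b) (h : |x * S - R| * b = a) :
    S ^ 2 * |x - R / S| = a * S / b := by
  have e : x - R / S = (x * S - R) / S := by field_simp
  rw [e, abs_div, abs_of_pos hS, ← h]
  field_simp

lemma BackwardOrbits.theta_eq (B : BackwardOrbits l m L H) {x : ℝ}
    (hx : x ∈ Set.Ico (-(l / 2)) (l / 2)) (hirr : Irr l x) (n : ℕ) :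
    theta l x n = |(tv l x n).1| / (1 + (tv l x n).1 * (tv l x n).2) := by
  obtain ⟨h1, h2, h3, h4⟩ := B.RS_spec hx hirr n
  have hp := (B.inDomain_tv hx hirr n).one_add_pos B
  rw [theta, Rnum, Snum]
  have hb : 0 < (RS l x n).2.2 + (tv l x n).1 * (RS l x n).2.1 := by
    rw [h2]
    nlinarith [mul_pos hp h1]
  rw [sq_mul_abs_sub_div (a := |(tv l x n).1|) h1 hb, h2]
  · field_simp
  · rw [← abs_of_pos hb, ← abs_mul, ← mul_one |(tv l x n).1|, ← h4, ← abs_mul]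
    congr 1
    linear_combination (RS l x n).2.2 * h3

lemma BackwardOrbits.theta_pred_eq (B : BackwardOrbits l m L H) {x : ℝ}
    (hx : x ∈ Set.Ico (-(l / 2)) (l / 2)) (hirr : Irr l x) (n : ℕ) :
    theta l x n =
      (tv l x (n + 1)).2 / (1 + (tv l x (n + 1)).1 * (tv l x (n + 1)).2) := by
  obtain ⟨h1, h2, h3, h4⟩ := B.RS_spec hx hirr (n + 1)
  have hp := (B.inDomain_tv hx hirr (n + 1)).one_add_pos B
  have hS : 0 < Snum l x n := (B.RS_spec hx hirr n).1
  have hb : 0 < (RS l x (n + 1)).2.2 + (tv l x (n + 1)).1 * (RS l x (n + 1)).2.1 := by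
    rw [h2]
    nlinarith [mul_pos hp h1]
  rw [theta, sq_mul_abs_sub_div (a := 1) hS hb]
  · rw [← (RS_succ_fst l x n).2, h2]
    field_simp
  · rw [← (RS_succ_fst l x n).2, ← (RS_succ_fst l x n).1, ← abs_of_pos hb, ← abs_mul, ← h4,
      ← abs_neg]
    congr 1
    linear_combination (-(RS l x (n + 1)).2.1) * h3

end Dynamics

/-- for every `G_q`-irrational `x` infinitely many `(t_n,v_n)` lie outside `D`. -/
theorem infinitely_often_outside_D_even (q p : ℕ) (hp : 2 ≤ p) (hq : q = 2 * p)
    (x : ℝ) (hx : x ∈ Set.Ico (-(lam q / 2)) (lam q / 2)) (hirr : Irr (lam q) x) :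
    {n : ℕ | 1 ≤ n ∧ tv (lam q) x n ∉ DE (lam q) p}.Infinite ∧
    {n : ℕ | 1 ≤ n ∧ min (theta (lam q) x (n - 1)) (theta (lam q) x n) ≤ 1 / 2}.Infinite := by
  subst hq
  obtain ⟨L, H, B⟩ := exists_backwardOrbits hp
  have key : ∀ N, ∃ n, N < n ∧
      ¬ (1 / 2 < (tv (lam (2 * p)) x n).2 /
          (1 + (tv (lam (2 * p)) x n).1 * (tv (lam (2 * p)) x n).2) ∧
        1 / 2 < |(tv (lam (2 * p)) x n).1| /
          (1 + (tv (lam (2 * p)) x n).1 * (tv (lam (2 * p)) x n).2)) :=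
    fun N => B.exists_coeff_le hx hirr (N + 1)
  constructor
  · refine Set.infinite_of_forall_exists_gt fun N => ?_
    obtain ⟨n, hn, h⟩ := key N
    exact ⟨n, ⟨by omega, fun hD => h hD.2⟩, hn⟩
  · refine Set.infinite_of_forall_exists_gt fun N => ?_
    obtain ⟨n, hn, h⟩ := key N
    refine ⟨n, ⟨by omega, ?_⟩, hn⟩
    obtain ⟨k, rfl⟩ : ∃ k, n = k + 1 := ⟨n - 1, by omega⟩
    rw [Nat.add_sub_cancel, B.theta_pred_eq hx hirr k, B.theta_eq hx hirr (k + 1), ← not_lt,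
      lt_min_iff]
    exact h

end RosenTong
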